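/- arXiv:math/0602085 — 4 statements merged into one kernel-verified Lean document; each statement's English description precedes it below -/
import Mathlib

section
/- Let λ_0, λ_1, …, λ_j be ordered partitions of {1,…,k} forming a chain λ_j ≤ λ_{j−1} ≤ ⋯ ≤ λ_0 (each λ_t is a subdivision of λ_{t+1}), and let σ ∈ Σ_k be a permutation with λ_j ≤ σ. Then every point of the convex hull in ℂ^k of the Salvetti vertices v(λ_0, λ_0∘σ), v(λ_1, λ_1∘σ), …, v(λ_j, λ_j∘σ) has pairwise distinct complex coordinates; that is, the geometric simplex s(λ_0,…,λ_j;σ) of the Salvetti complex Sal(A_{k−1}) is contained in the complement of the complexified braid arrangement. -/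
/-- An ordered partition of `{1,…,k}`: a map `Fin k → ℕ` whose range is `{1,…,m}`
for some `m` (necessarily `m = k - r` where `r` is the rank). -/
def IsOP (k : ℕ) (f : Fin k → ℕ) : Prop := ∃ m : ℕ, Set.range f = Set.Icc 1 m

/-- `LeOP μ λ` means `μ ≤ λ`, i.e. `λ` is a subdivision of `μ`. -/
def LeOP {k : ℕ} (mu lam : Fin k → ℕ) : Prop :=
  ∀ i j : Fin k, (lam i = lam j → mu i = mu j) ∧ (lam i < lam j → mu i ≤ mu j)

/-- `IsComp λ μ ν` means `ν = λ∘μ`, the face-face product of ordered partitions. -/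
def IsComp {k : ℕ} (lam mu nu : Fin k → ℕ) : Prop :=
  IsOP k nu ∧ ∀ i j : Fin k, nu i < nu j ↔ (lam i < lam j ∨ (lam i = lam j ∧ mu i < mu j))

/-- The Salvetti vertex `v(λ,σ)`, with `m`-th coordinate `λ(m) + i(σ(m) − λ(m))`. -/
def salVertex {k : ℕ} (lam sigma : Fin k → ℕ) : Fin k → ℂ :=
  fun m => (lam m : ℂ) + Complex.I * ((sigma m : ℂ) - (lam m : ℂ))

/-- The half-plane `re > 0` together with one open half of its boundary line is convex. -/
theorem convex_setOf_lex_pos (e : ℝ) :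
    Convex ℝ {w : ℂ | 0 < w.re ∨ (w.re = 0 ∧ 0 < e * w.im)} := by
  intro x hx y hy s t hs ht hst
  simp only [Set.mem_ofPred_eq, Complex.add_re, Complex.add_im, Complex.real_smul,
    Complex.re_ofReal_mul, Complex.im_ofReal_mul] at *
  rcases hs.eq_or_lt with rfl | hs
  · obtain rfl : t = 1 := by linarith
    simpa using hy
  rcases ht.eq_or_lt with rfl | ht
  · obtain rfl : s = 1 := by linarith
    simpa using hx
  rcases hx with hx | ⟨hx, hx'⟩ <;> rcases hy with hy | ⟨hy, hy'⟩
  · left; positivity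
  · left; rw [hy]; simp; positivity
  · left; rw [hx]; simp; positivity
  · right
    refine ⟨by rw [hx, hy]; simp, ?_⟩
    have := mul_pos hs hx'
    have := mul_pos ht hy'
    linarith

theorem injective_of_range_eq_Icc {k : ℕ} {f : Fin k → ℕ}
    (hf : Set.range f = Set.Icc 1 k) : Function.Injective f := by
  classical
  rw [← Set.injOn_univ, ← Finset.coe_univ, ← Finset.card_image_iff]
  have : Finset.univ.image f = Finset.Icc 1 k := by
    rw [← Finset.coe_inj]
    simpa using hf
  simp [this]

/-- Along a chain of ordered partitions, the comparison of two indices in the finest partition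
decides a lexicographic half-plane containing all the coordinate differences. -/
theorem salVertex_sub_mem_lex_pos {k : ℕ} {fine lam sigma nu : Fin k → ℕ} (hle : LeOP lam fine)
    (hnu : IsComp lam sigma nu) {a b : Fin k} (hab : fine a ≤ fine b)
    (hne : sigma a ≠ sigma b) :
    salVertex lam nu b - salVertex lam nu a ∈
      {w : ℂ | 0 < w.re ∨ (w.re = 0 ∧ 0 < ((sigma b : ℝ) - sigma a) * w.im)} := by
  have hlam : lam a ≤ lam b := by
    rcases hab.eq_or_lt with h | h
    · exact ((hle a b).1 h).le
    · exact (hle a b).2 h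
  have h1 := hnu.2 a b
  have h2 := hnu.2 b a
  simp only [salVertex, Set.mem_ofPred_eq, Complex.sub_re, Complex.sub_im, Complex.add_re,
    Complex.add_im, Complex.natCast_re, Complex.natCast_im, Complex.I_mul_re, Complex.I_mul_im]
  rcases hlam.eq_or_lt with h | h
  · right
    refine ⟨by simp [h], ?_⟩
    rw [h]
    rcases lt_or_gt_of_ne hne with hs | hs
    · have hn : (nu a : ℝ) < nu b := by exact_mod_cast h1.2 (Or.inr ⟨h, hs⟩)
      have hs' : (sigma a : ℝ) < sigma b := by exact_mod_cast hs
      nlinarith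
    · have hn : (nu b : ℝ) < nu a := by exact_mod_cast h2.2 (Or.inr ⟨h.symm, hs⟩)
      have hs' : (sigma b : ℝ) < sigma a := by exact_mod_cast hs
      nlinarith
  · left
    have : (lam a : ℝ) < lam b := by exact_mod_cast h
    simpa using this

/-- Every point of the geometric simplex `s(λ_0,…,λ_j;σ)` of the Salvetti complex of the
braid arrangement has pairwise distinct complex coordinates. -/
theorem stmt0 (k j : ℕ) (Λ : Fin (j + 1) → Fin k → ℕ)
    (hOP : ∀ t, IsOP k (Λ t))
    (hchain : ∀ s t : Fin (j + 1), s ≤ t → LeOP (Λ t) (Λ s))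
    (sigma : Fin k → ℕ) (hsigma : Set.range sigma = Set.Icc 1 k)
    (hle : LeOP (Λ (Fin.last j)) sigma)
    (nu : Fin (j + 1) → Fin k → ℕ) (hnu : ∀ t, IsComp (Λ t) sigma (nu t))
    (z : Fin k → ℂ)
    (hz : z ∈ convexHull ℝ (Set.range fun t => salVertex (Λ t) (nu t))) :
    ∀ a b : Fin k, a ≠ b → z a ≠ z b := by
  have hinj := injective_of_range_eq_Icc hsigma
  intro a b hab
  wlog h0 : Λ 0 a ≤ Λ 0 b generalizing a b
  · exact (this b a hab.symm (le_of_not_ge h0)).symm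
  have hmem : z b - z a ∈
      {w : ℂ | 0 < w.re ∨ (w.re = 0 ∧ 0 < ((sigma b : ℝ) - sigma a) * w.im)} := by
    let f : (Fin k → ℂ) →ₗ[ℝ] ℂ :=
      LinearMap.proj (R := ℝ) (φ := fun _ => ℂ) b - LinearMap.proj a
    refine convexHull_min (t := f ⁻¹' _) ?_ ((convex_setOf_lex_pos _).linear_preimage f) hz
    rintro _ ⟨t, rfl⟩
    exact salVertex_sub_mem_lex_pos (hchain 0 t (Fin.zero_le t)) (hnu t) h0 (hinj.ne hab)
  intro heq
  simp [heq] at hmem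
end

section
/- Let ℓ_1, …, ℓ_m be finitely many linear functionals on a finite-dimensional real vector space V and let x, y, z ∈ V. Then there exists ε₀ > 0 such that for all ε with 0 < ε < ε₀ and every j ∈ {1,…,m}: sign(ℓ_j(x + εy + ε²z)) equals sign(ℓ_j(x)) if ℓ_j(x) ≠ 0; equals sign(ℓ_j(y)) if ℓ_j(x) = 0 and ℓ_j(y) ≠ 0; and equals sign(ℓ_j(z)) if ℓ_j(x) = ℓ_j(y) = 0. (This realizes the associativity of the face-face pairing F∘(G∘H) = (F∘G)∘H of a real central arrangement.) -/
open Filter Topology in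
/-- The sign of a real function is locally constant at a point of continuity where the function
does not vanish. -/
theorem eventually_real_sign_eq {X : Type*} [TopologicalSpace X] {f : X → ℝ} {a : X}
    (hf : ContinuousAt f a) (ha : f a ≠ 0) :
    ∀ᶠ t in 𝓝 a, Real.sign (f t) = Real.sign (f a) := by
  rcases lt_or_gt_of_ne ha with h | h
  · filter_upwards [hf.eventually_lt_const h] with t ht
    rw [Real.sign_of_neg ht, Real.sign_of_neg h]
  · filter_upwards [hf.eventually_const_lt h] with t ht
    rw [Real.sign_of_pos ht, Real.sign_of_pos h]

theorem real_sign_pos_mul {r : ℝ} (hr : 0 < r) (a : ℝ) :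
    Real.sign (r * a) = Real.sign a := by
  rcases lt_trichotomy a 0 with h | rfl | h
  · rw [Real.sign_of_neg h, Real.sign_of_neg (mul_neg_of_pos_of_neg hr h)]
  · rw [mul_zero]
  · rw [Real.sign_of_pos h, Real.sign_of_pos (mul_pos hr h)]

open Filter Topology in
/-- For small positive `t`, the sign of `a + t b + t² c` is that of its first nonzero
coefficient. -/
theorem eventually_real_sign_quadratic (a b c : ℝ) :
    ∀ᶠ t in 𝓝[>] (0 : ℝ),
      (a ≠ 0 → Real.sign (a + t * b + t ^ 2 * c) = Real.sign a) ∧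
      (a = 0 → b ≠ 0 → Real.sign (a + t * b + t ^ 2 * c) = Real.sign b) ∧
      (a = 0 → b = 0 → Real.sign (a + t * b + t ^ 2 * c) = Real.sign c) := by
  have hconst : ∀ᶠ t in 𝓝[>] (0 : ℝ),
      a ≠ 0 → Real.sign (a + t * b + t ^ 2 * c) = Real.sign a := by
    refine eventually_imp_distrib_left.2 fun ha => ?_
    have hcont : ContinuousAt (fun t : ℝ => a + t * b + t ^ 2 * c) 0 := by fun_prop
    simpa using (eventually_real_sign_eq hcont (by simpa using ha)).filter_mono nhdsWithin_le_nhds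
  have hlinear : ∀ᶠ t in 𝓝[>] (0 : ℝ), b ≠ 0 → Real.sign (b + t * c) = Real.sign b := by
    refine eventually_imp_distrib_left.2 fun hb => ?_
    have hcont : ContinuousAt (fun t : ℝ => b + t * c) 0 := by fun_prop
    simpa using (eventually_real_sign_eq hcont (by simpa using hb)).filter_mono nhdsWithin_le_nhds
  filter_upwards [hconst, hlinear, self_mem_nhdsWithin] with t h₁ h₂ ht
  refine ⟨h₁, fun ha hb => ?_, fun ha hb => ?_⟩
  · rw [← h₂ hb, ← real_sign_pos_mul ht (b + t * c), ha]
    ring_nf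
  · rw [← real_sign_pos_mul (pow_pos ht 2) c, ha, hb]
    ring_nf


/-- A second-order perturbation `x + εy + ε²z` has sign vector given by the composite of the
sign vectors of `x`, `y`, `z` in lexicographic order: this realizes the associativity
`F∘(G∘H) = (F∘G)∘H` of the face-face pairing of a real central arrangement. -/
theorem stmt4 (V : Type*) [AddCommGroup V] [Module ℝ V] [FiniteDimensional ℝ V]
    (m : ℕ) (L : Fin m → V →ₗ[ℝ] ℝ) (x y z : V) :
    ∃ ε₀ > (0 : ℝ), ∀ ε : ℝ, 0 < ε → ε < ε₀ → ∀ j : Fin m,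
      (L j x ≠ 0 → Real.sign (L j (x + ε • y + ε ^ 2 • z)) = Real.sign (L j x)) ∧
      (L j x = 0 → L j y ≠ 0 →
        Real.sign (L j (x + ε • y + ε ^ 2 • z)) = Real.sign (L j y)) ∧
      (L j x = 0 → L j y = 0 →
        Real.sign (L j (x + ε • y + ε ^ 2 • z)) = Real.sign (L j z)) := by
  obtain ⟨ε₀, hε₀, hsub⟩ := mem_nhdsGT_iff_exists_Ioo_subset.1
    (Filter.eventually_all.2 fun j => eventually_real_sign_quadratic (L j x) (L j y) (L j z))
  refine ⟨ε₀, hε₀, fun ε hpos hlt j => ?_⟩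
  simpa only [map_add, map_smul, smul_eq_mul] using hsub ⟨hpos, hlt⟩ j
end

section
/- Let λ, μ be ordered partitions of {1,…,k}, let x ∈ F_λ and y ∈ F_μ. Then there exists ε₀ > 0 such that x + εy ∈ F_{λ∘μ} for all ε with 0 < ε < ε₀. -/
/-- The face `F_λ` of the braid arrangement `B_k` in `ℝ^k`. -/
def Face {k : ℕ} (lam : Fin k → ℕ) : Set (Fin k → ℝ) :=
  {x | ∀ i j : Fin k, (lam i < lam j → x i < x j) ∧ (lam i = lam j → x i = x j)}

open Filter Topology in
theorem eventually_add_smul_mem_face {k : ℕ} {lam mu nu : Fin k → ℕ} (hnu : IsComp lam mu nu)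
    {x y : Fin k → ℝ} (hx : x ∈ Face lam) (hy : y ∈ Face mu) :
    ∀ᶠ ε in 𝓝[>] (0 : ℝ), x + ε • y ∈ Face nu := by
  have hlt : ∀ᶠ ε in 𝓝[>] (0 : ℝ), ∀ i j, x i < x j → x i + ε * y i < x j + ε * y j := by
    refine eventually_all.2 fun i => eventually_all.2 fun j => ?_
    by_cases h : x i < x j
    · have hlim (l : Fin k) : Tendsto (fun ε : ℝ => x l + ε * y l) (𝓝 0) (𝓝 (x l)) :=
        Continuous.tendsto' (by fun_prop) _ _ (by simp)
      filter_upwards [((hlim i).eventually_lt (hlim j) h).filter_mono nhdsWithin_le_nhds]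
        with ε hε _ using hε
    · simp [h]
  filter_upwards [hlt, self_mem_nhdsWithin] with ε hε (hpos : 0 < ε) i j
  simp only [Pi.add_apply, Pi.smul_apply, smul_eq_mul]
  refine ⟨fun hij => ?_, fun hij => ?_⟩
  · rcases (hnu.2 i j).1 hij with h | ⟨h, h'⟩
    · exact hε i j ((hx i j).1 h)
    · rw [(hx i j).2 h]
      gcongr
      exact (hy i j).1 h'
  · have h₁ := hnu.2 i j
    have h₂ := hnu.2 j i
    rw [(hx i j).2 (by omega), (hy i j).2 (by omega)]

/-- If `x ∈ F_λ` and `y ∈ F_μ`, then `x + εy ∈ F_{λ∘μ}` for all sufficiently small `ε > 0`. -/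
theorem stmt6 (k : ℕ) (lam mu nu : Fin k → ℕ) (hlam : IsOP k lam) (hmu : IsOP k mu)
    (hnu : IsComp lam mu nu) (x y : Fin k → ℝ) (hx : x ∈ Face lam) (hy : y ∈ Face mu) :
    ∃ ε₀ > (0 : ℝ), ∀ ε : ℝ, 0 < ε → ε < ε₀ → x + ε • y ∈ Face nu := by
  obtain ⟨ε₀, hε₀, h⟩ :=
    mem_nhdsGT_iff_exists_Ioo_subset.1 (eventually_add_smul_mem_face hnu hx hy)
  exact ⟨ε₀, hε₀, fun ε hpos hlt => h ⟨hpos, hlt⟩⟩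
end

section
/- Consider the set P_r = {(λ, σ) : λ ∈ Π_{k,r}, σ ∈ Σ_k, λ ≤ σ} of labels of the (k−r)-cells of the Salvetti complex of the braid arrangement, with the right Σ_k-action (λ, σ)·ρ = (λ∘ρ, σ∘ρ) by precomposition. This action is well defined (λ∘ρ ≤ σ∘ρ whenever λ ≤ σ) and free, and every orbit contains exactly one pair of the form (λ₀, id) with λ₀ an order-preserving partition; hence P_r is in Σ_k-equivariant bijection with O_{k,r} × Σ_k. -/
/-- The set `P_r` of labels `(λ,σ)`, `λ ∈ Π_{k,r}`, `σ ∈ Σ_k`, `λ ≤ σ`, of the `(k−r)`-cells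
of the Salvetti complex of the braid arrangement. An ordered partition of rank `r` is
encoded as a map `Fin k → ℕ` with range `{1,…,k−r}`; permutations have range `{1,…,k}`. -/
def CellLabels (k r : ℕ) :=
  {p : (Fin k → ℕ) × (Fin k → ℕ) //
    Set.range p.1 = Set.Icc 1 (k - r) ∧ Set.range p.2 = Set.Icc 1 k ∧ LeOP p.1 p.2}

/-- The permutation `e` of `Fin k`, written as a map onto `{1,…,k}`. -/
def permLabel {k : ℕ} (e : Equiv.Perm (Fin k)) : Fin k → ℕ := fun i => (e i : ℕ) + 1

theorem permLabel_injective {k : ℕ} :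
    Function.Injective (permLabel : Equiv.Perm (Fin k) → Fin k → ℕ) := by
  intro e f h
  ext i
  simpa [permLabel] using congrFun h i

theorem range_permLabel {k : ℕ} (e : Equiv.Perm (Fin k)) :
    Set.range (permLabel e) = Set.Icc 1 k := by
  ext n
  simp only [Set.mem_range, Set.mem_Icc, permLabel]
  constructor
  · rintro ⟨i, rfl⟩
    have := (e i).isLt
    omega
  · rintro ⟨h1, h2⟩
    refine ⟨e.symm ⟨n - 1, by omega⟩, ?_⟩
    rw [e.apply_symm_apply]
    exact Nat.sub_add_cancel h1

theorem exists_permLabel_eq {k : ℕ} {sig : Fin k → ℕ} (h : Set.range sig = Set.Icc 1 k) :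
    ∃ e : Equiv.Perm (Fin k), permLabel e = sig := by
  have hmem (i : Fin k) : 1 ≤ sig i ∧ sig i ≤ k := by
    rw [← Set.mem_Icc, ← h]
    exact Set.mem_range_self i
  let f : Fin k → Fin k := fun i => ⟨sig i - 1, by have := hmem i; omega⟩
  have hf : Function.Surjective f := by
    intro j
    have hj : (j : ℕ) + 1 ∈ Set.range sig := by
      rw [h, Set.mem_Icc]
      have := j.isLt
      omega
    obtain ⟨i, hi⟩ := hj
    exact ⟨i, Fin.ext (by simp [f, hi])⟩
  refine ⟨Equiv.ofBijective f (Finite.surjective_iff_bijective.mp hf), ?_⟩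
  funext i
  exact Nat.sub_add_cancel (hmem i).1

theorem leOP_permLabel_iff {k : ℕ} {lam : Fin k → ℕ} {e : Equiv.Perm (Fin k)} :
    LeOP lam (permLabel e) ↔ Monotone (lam ∘ e.symm) := by
  constructor
  · intro h a b hab
    rcases hab.eq_or_lt with rfl | hab
    · exact le_rfl
    · exact (h (e.symm a) (e.symm b)).2 (by simpa [permLabel] using hab)
  · intro h i j
    refine ⟨fun hij => ?_, fun hij => ?_⟩
    · have : e i = e j := Fin.ext (Nat.succ_injective hij)
      rw [e.injective this]
    · have hle : e i ≤ e j := Fin.le_def.mpr (by simp only [permLabel] at hij; omega)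
      simpa using h hle

/-- The permutation underlying the second component of a cell label. -/
noncomputable def CellLabels.perm {k r : ℕ} (p : CellLabels k r) : Equiv.Perm (Fin k) :=
  (exists_permLabel_eq p.2.2.1).choose

theorem CellLabels.permLabel_perm {k r : ℕ} (p : CellLabels k r) : permLabel p.perm = p.1.2 :=
  (exists_permLabel_eq p.2.2.1).choose_spec

/-- The order-preserving partition `λ ∘ σ⁻¹` attached to a cell label `(λ,σ)`. -/
noncomputable def CellLabels.sorted {k r : ℕ} (p : CellLabels k r) :
    {g : Fin k → ℕ // Set.range g = Set.Icc 1 (k - r) ∧ Monotone g} :=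
  ⟨p.1.1 ∘ p.perm.symm, by rw [p.perm.symm.surjective.range_comp]; exact p.2.1,
    leOP_permLabel_iff.mp (p.permLabel_perm ▸ p.2.2.2)⟩

theorem CellLabels.bijective_sorted_perm {k r : ℕ} :
    Function.Bijective (fun p : CellLabels k r => (p.sorted, p.perm)) := by
  constructor
  · intro p q h
    obtain ⟨hs, hp⟩ := Prod.mk.inj h
    refine Subtype.ext (Prod.ext ?_ ?_)
    · have hs' : p.1.1 ∘ p.perm.symm = q.1.1 ∘ q.perm.symm := congrArg Subtype.val hs
      rw [hp] at hs'
      exact q.perm.symm.surjective.injective_comp_right hs'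
    · rw [← p.permLabel_perm, ← q.permLabel_perm, hp]
  · rintro ⟨⟨g, hg, hmono⟩, e⟩
    have hge : (g ∘ e) ∘ e.symm = g := by
      funext i
      simp
    let p : CellLabels k r := ⟨(g ∘ e, permLabel e), by rw [e.surjective.range_comp]; exact hg,
      range_permLabel e, leOP_permLabel_iff.mpr (by rwa [hge])⟩
    have hp : p.perm = e := permLabel_injective p.permLabel_perm
    refine ⟨p, Prod.ext (Subtype.ext ?_) hp⟩
    change (g ∘ e) ∘ p.perm.symm = g
    rw [hp, hge]

theorem CellLabels.perm_of_comp {k r : ℕ} {p q : CellLabels k r} {ρ : Equiv.Perm (Fin k)}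
    (h : q.1.2 = fun i => p.1.2 (ρ i)) : q.perm = p.perm * ρ := by
  apply permLabel_injective
  rw [q.permLabel_perm, h, ← p.permLabel_perm]
  rfl

theorem CellLabels.sorted_of_comp {k r : ℕ} {p q : CellLabels k r} {ρ : Equiv.Perm (Fin k)}
    (h₁ : q.1.1 = fun i => p.1.1 (ρ i)) (h₂ : q.1.2 = fun i => p.1.2 (ρ i)) :
    q.sorted = p.sorted := by
  apply Subtype.ext
  change q.1.1 ∘ q.perm.symm = p.1.1 ∘ p.perm.symm
  rw [h₁, perm_of_comp h₂]
  funext i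
  exact congrArg p.1.1 (ρ.apply_symm_apply _)

/-- The right `Σ_k`-action `(λ,σ)·ρ = (λ∘ρ, σ∘ρ)` on the cell labels `P_r` is well defined
and free, every orbit contains exactly one pair `(λ₀, id)` with `λ₀` order-preserving, and
`P_r` is `Σ_k`-equivariantly in bijection with `O_{k,r} × Σ_k`. -/
theorem stmt14 (k r : ℕ) (hr : r < k) :
    -- the action is well defined: it preserves the condition λ ≤ σ (and the ranks)
    (∀ (lam sig : Fin k → ℕ) (ρ : Equiv.Perm (Fin k)), LeOP lam sig →
      (Set.range (fun i => lam (ρ i)) = Set.range lam ∧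
       Set.range (fun i => sig (ρ i)) = Set.range sig ∧
       LeOP (fun i => lam (ρ i)) (fun i => sig (ρ i)))) ∧
    -- the action is free
    (∀ (lam sig : Fin k → ℕ) (ρ : Equiv.Perm (Fin k)),
      Set.range lam = Set.Icc 1 (k - r) → Set.range sig = Set.Icc 1 k → LeOP lam sig →
      (fun i => lam (ρ i)) = lam → (fun i => sig (ρ i)) = sig → ρ = 1) ∧
    -- every orbit contains exactly one pair of the form (λ₀, id) with λ₀ order-preserving
    (∀ lam sig : Fin k → ℕ,
      Set.range lam = Set.Icc 1 (k - r) → Set.range sig = Set.Icc 1 k → LeOP lam sig →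
      ∃! ρ : Equiv.Perm (Fin k),
        Monotone (fun i => lam (ρ i)) ∧ (fun i => sig (ρ i)) = fun i : Fin k => (i : ℕ) + 1) ∧
    -- hence P_r is Σ_k-equivariantly in bijection with O_{k,r} × Σ_k
    (∃ (φ : CellLabels k r → {g : Fin k → ℕ // Set.range g = Set.Icc 1 (k - r) ∧ Monotone g})
       (ψ : CellLabels k r → Equiv.Perm (Fin k)),
      Function.Bijective (fun p => (φ p, ψ p)) ∧
      ∀ (p q : CellLabels k r) (ρ : Equiv.Perm (Fin k)),
        q.1.1 = (fun i => p.1.1 (ρ i)) → q.1.2 = (fun i => p.1.2 (ρ i)) →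
        φ q = φ p ∧ ψ q = ψ p * ρ) := by
  refine ⟨?_, ?_, ?_, CellLabels.sorted, CellLabels.perm, CellLabels.bijective_sorted_perm,
    fun p q ρ h₁ h₂ => ⟨CellLabels.sorted_of_comp h₁ h₂, CellLabels.perm_of_comp h₂⟩⟩
  · exact fun lam sig ρ h => ⟨ρ.surjective.range_comp lam, ρ.surjective.range_comp sig,
      fun i j => h (ρ i) (ρ j)⟩
  · intro lam sig ρ _ hsig _ _ hρ
    obtain ⟨e, rfl⟩ := exists_permLabel_eq hsig
    have : e * ρ = e := permLabel_injective hρ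
    exact mul_eq_left.mp this
  · intro lam sig _ hsig hle
    obtain ⟨e, rfl⟩ := exists_permLabel_eq hsig
    refine ⟨e⁻¹, ⟨leOP_permLabel_iff.mp hle, ?_⟩, ?_⟩
    · funext i
      simp [permLabel]
    · rintro ρ ⟨-, hρ⟩
      have : e * ρ = 1 := permLabel_injective hρ
      exact eq_inv_of_mul_eq_one_right this
end
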